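/- Let I be a set admitting an injection into A, and let U be an ultrafilter on I. Then the ultrapower ∏_U A is generated by a single element: there exists an element x of ∏_U A such that the L_A-substructure of ∏_U A generated by {x} is all of ∏_U A. -/

import Mathlib

open FirstOrder Language

/-- The language whose `n`-ary function symbols are all functions `(Fin n → A) → A`. -/
abbrev LA (A : Type*) : FirstOrder.Language := ⟨fun n => (Fin n → A) → A, fun _ => Empty⟩

/-- The full clone structure `Ω(A)` on `A`. -/
instance OmegaStructure (A : Type*) : (LA A).Structure A :=
  ⟨fun f x => f x, fun r => r.elim⟩

/-- If `I` admits an injection into `A` and `U` is an ultrafilter on `I`, then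
the ultrapower `∏_U A` is generated by a single element. -/
theorem stmt_19 (A : Type*) [Infinite A] (I : Type*) (e : I → A) (he : Function.Injective e)
    (U : Ultrafilter I) :
    ∃ x : (U : Filter I).Product fun _ : I => A,
      Substructure.closure (LA A) ({x} : Set ((U : Filter I).Product fun _ : I => A)) = ⊤ := by
  let q : (I → A) → (U : Filter I).Product fun _ : I => A := fun y => Quotient.mk'' y
  refine ⟨q e, ?_⟩
  rw [eq_top_iff]
  intro z _
  induction z using Quotient.inductionOn' with
  | h y =>
    let f : (LA A).Functions 1 := fun v => Function.extend e y id (v 0)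
    have h := Ultraproduct.funMap_cast (u := U) (M := fun _ : I => A) f (fun _ => e)
    have h2 : (fun a => Structure.funMap f fun _ : Fin 1 => e a) = y := by
      funext a
      exact he.extend_apply y id a
    have h3 := (Substructure.closure (LA A) {q e}).fun_mem f (fun _ => q e)
      (fun _ => Substructure.subset_closure rfl)
    rw [h2] at h
    exact (congrArg (· ∈ Substructure.closure (LA A) {q e}) h).mp h3
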